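/- Let (k_n)_{n≥1} enumerate the integer Cantor set C_{b,D} (with 0 ∈ D) in increasing order. Then for every q ∈ ℕ and every residue a ∈ ℤ/qℤ, the limit π_q(a) = lim_{N→∞} (1/N) |{ n ≤ N : k_n ≡ a (mod q) }| exists, and π_q(0) > 0 for all q. -/

import Mathlib

open MeasureTheory Filter Finset

/-- The integer Cantor set with base `b` and digit set `D`. -/
def intCantorSet (b : ℕ) (D : Finset ℕ) : Set ℕ :=
  {m | ∀ d ∈ Nat.digits b m, d ∈ D}

/-- The average of `g` over the `u`-th block of `R` consecutive integers. -/
noncomputable def blockAvg (R : ℕ) (g : ℕ → ℝ) (u : ℕ) : ℝ :=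
  (∑ v ∈ range R, g (R * u + v)) / R

theorem mul_blockAvg {R : ℕ} (hR : 0 < R) (g : ℕ → ℝ) (u : ℕ) :
    R * blockAvg R g u = ∑ v ∈ range R, g (R * u + v) := by
  have : (R : ℝ) ≠ 0 := by positivity
  unfold blockAvg
  field_simp

theorem le_blockAvg {R : ℕ} (hR : 0 < R) {g : ℕ → ℝ} {c : ℝ} (h : ∀ u, c ≤ g u) (u : ℕ) :
    c ≤ blockAvg R g u := by
  have hR' : (0 : ℝ) < R := by positivity
  rw [blockAvg, le_div_iff₀ hR']
  calc c * R = ∑ v ∈ range R, c := by simp [mul_comm]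
    _ ≤ _ := sum_le_sum fun v _ => h _

theorem blockAvg_le {R : ℕ} (hR : 0 < R) {g : ℕ → ℝ} {c : ℝ} (h : ∀ u, g u ≤ c) (u : ℕ) :
    blockAvg R g u ≤ c := by
  have hR' : (0 : ℝ) < R := by positivity
  rw [blockAvg, div_le_iff₀ hR']
  calc _ ≤ ∑ v ∈ range R, c := sum_le_sum fun v _ => h _
    _ = c * R := by simp [mul_comm]

theorem le_iterate_blockAvg {R : ℕ} (hR : 0 < R) {g : ℕ → ℝ} {c : ℝ} (h : ∀ u, c ≤ g u)
    (i u : ℕ) : c ≤ (blockAvg R)^[i] g u := by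
  induction i generalizing g with
  | zero => exact h u
  | succ i ih => exact ih (le_blockAvg hR h)

theorem iterate_blockAvg_le {R : ℕ} (hR : 0 < R) {g : ℕ → ℝ} {c : ℝ} (h : ∀ u, g u ≤ c)
    (i u : ℕ) : (blockAvg R)^[i] g u ≤ c := by
  induction i generalizing g with
  | zero => exact h u
  | succ i ih => exact ih (blockAvg_le hR h)

/-- If every block contains a point where `g` takes the value `g 0`, then averaging over blocks
shrinks the range of `g` by the factor `1 - 1 / R`. -/
theorem exists_blockAvg_mem_Icc {R : ℕ} (hR : 0 < R) {g : ℕ → ℝ} {lo δ : ℝ}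
    (hg : ∀ u, lo ≤ g u ∧ g u ≤ lo + δ) (h0 : ∀ u, ∃ v < R, g (R * u + v) = g 0) :
    ∃ lo', ∀ u, lo' ≤ blockAvg R g u ∧ blockAvg R g u ≤ lo' + (1 - 1 / R) * δ := by
  have hR' : (0 : ℝ) < R := by positivity
  refine ⟨(g 0 + (R - 1) * lo) / R, fun u => ?_⟩
  obtain ⟨v, hv, hgv⟩ := h0 u
  have hcard : (((range R).erase v).card : ℝ) = R - 1 := by
    rw [card_erase_of_mem (mem_range.2 hv), card_range, Nat.cast_sub hR, Nat.cast_one]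
  have hsum := add_sum_erase (range R) (fun w => g (R * u + w)) (mem_range.2 hv)
  have hlo : (R - 1) * lo ≤ ∑ w ∈ (range R).erase v, g (R * u + w) := by
    rw [← hcard, ← nsmul_eq_mul]
    exact card_nsmul_le_sum _ _ _ fun w _ => (hg _).1
  have hhi : ∑ w ∈ (range R).erase v, g (R * u + w) ≤ (R - 1) * (lo + δ) := by
    rw [← hcard, ← nsmul_eq_mul]
    exact sum_le_card_nsmul _ _ _ fun w _ => (hg _).2
  have e : (g 0 + (R - 1) * lo) / R + (1 - 1 / R) * δ = (g 0 + (R - 1) * (lo + δ)) / R := by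
    field_simp
    ring
  rw [e, blockAvg, ← hsum, hgv]
  constructor <;> gcongr

theorem exists_abs_iterate_blockAvg_sub_le {R : ℕ} (hR : 0 < R) {g : ℕ → ℝ}
    (hg : ∀ u, 0 ≤ g u ∧ g u ≤ 1)
    (h0 : ∀ i u, ∃ v < R, (blockAvg R)^[i] g (R * u + v) = (blockAvg R)^[i] g 0) :
    ∃ L : ℝ, ∀ i u, |(blockAvg R)^[i] g u - L| ≤ (1 - 1 / (R : ℝ)) ^ i := by
  have hR' : (1 : ℝ) ≤ R := by exact_mod_cast hR
  have hinv : 0 < 1 / (R : ℝ) ∧ 1 / (R : ℝ) ≤ 1 := ⟨by positivity, by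
    rw [div_le_one (by positivity)]; exact hR'⟩
  have hlo : ∀ i, ∃ lo : ℝ, ∀ u, lo ≤ (blockAvg R)^[i] g u ∧
      (blockAvg R)^[i] g u ≤ lo + (1 - 1 / (R : ℝ)) ^ i := by
    intro i
    induction i with
    | zero => exact ⟨0, by simpa using hg⟩
    | succ i ih =>
      obtain ⟨lo, h⟩ := ih
      simp only [Function.iterate_succ_apply', pow_succ']
      exact exists_blockAvg_mem_Icc hR h (h0 i)
  have hdiff : ∀ i j u u', i ≤ j →
      |(blockAvg R)^[i] g u - (blockAvg R)^[j] g u'| ≤ (1 - 1 / (R : ℝ)) ^ i := by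
    intro i j u u' hij
    obtain ⟨lo, h⟩ := hlo i
    obtain ⟨m, rfl⟩ := Nat.exists_eq_add_of_le' hij
    rw [Function.iterate_add_apply]
    have h1 := le_iterate_blockAvg hR (fun u => (h u).1) m u'
    have h2 := iterate_blockAvg_le hR (fun u => (h u).2) m u'
    have h3 := h u
    rw [abs_le]
    constructor <;> linarith
  have hlim : Tendsto (fun i : ℕ => (1 - 1 / (R : ℝ)) ^ i) atTop (nhds 0) :=
    tendsto_pow_atTop_nhds_zero_of_lt_one (by linarith) (by linarith)
  have hcau : CauchySeq fun i => (blockAvg R)^[i] g 0 := by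
    refine cauchySeq_of_le_tendsto_0' _ (fun i j hij => ?_) hlim
    rw [Real.dist_eq]
    exact hdiff i j 0 0 hij
  obtain ⟨L, hL⟩ := cauchySeq_tendsto_of_complete hcau
  refine ⟨L, fun i u => ?_⟩
  refine le_of_tendsto ((hL.const_sub _).abs) ?_
  filter_upwards [eventually_ge_atTop i] with j hj
  exact hdiff i j u 0 hj

theorem sum_range_mul_blockAvg {R : ℕ} (hR : 0 < R) (g : ℕ → ℝ) (U : ℕ) :
    ∑ n ∈ range (R * U), g n = R * ∑ u ∈ range U, blockAvg R g u := by
  induction U with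
  | zero => simp
  | succ U ih =>
    rw [Nat.mul_succ, sum_range_add, ih, sum_range_succ, mul_add, mul_blockAvg hR]

theorem abs_sum_range_sub_le {R : ℕ} (hR : 0 < R) {L ε : ℝ} (i : ℕ) {g : ℕ → ℝ}
    (hg : ∀ u, 0 ≤ g u ∧ g u ≤ 1) (hL : |L| ≤ 1)
    (h : ∀ u, |(blockAvg R)^[i] g u - L| ≤ ε) :
    ∃ K : ℝ, ∀ N : ℕ, |∑ n ∈ range N, g n - N * L| ≤ ε * N + K := by
  have hε : 0 ≤ ε := (abs_nonneg _).trans (h 0)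
  have key : ∀ (f : ℕ → ℝ) (c : ℝ), (∀ n, |f n - L| ≤ c) →
      ∀ N : ℕ, |∑ n ∈ range N, f n - N * L| ≤ N * c := by
    intro f c hf N
    have e : ∑ n ∈ range N, f n - N * L = ∑ n ∈ range N, (f n - L) := by
      simp [sum_sub_distrib]
    rw [e]
    refine (abs_sum_le_sum_abs _ _).trans ?_
    refine (sum_le_card_nsmul _ _ c fun n _ => hf n).trans ?_
    simp
  induction i generalizing g with
  | zero => exact ⟨0, fun N => by simpa [mul_comm] using key g ε h N⟩
  | succ i ih =>
    obtain ⟨K, hK⟩ := ih (fun u => ⟨le_blockAvg hR (fun u => (hg u).1) u,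
      blockAvg_le hR (fun u => (hg u).2) u⟩) h
    refine ⟨R * K + R * 2, fun N => ?_⟩
    have hN : R * (N / R) + N % R = N := Nat.div_add_mod N R
    have hmod : ((N % R : ℕ) : ℝ) ≤ R := by exact_mod_cast (Nat.mod_lt N hR).le
    have h2 := key (fun n => g (R * (N / R) + n)) 2 (fun n => by
      have := hg (R * (N / R) + n)
      have := abs_le.1 hL
      rw [abs_le]; constructor <;> linarith) (N % R)
    have h1 := mul_le_mul_of_nonneg_left (hK (N / R)) (Nat.cast_nonneg (α := ℝ) R)
    rw [← abs_of_nonneg (Nat.cast_nonneg (α := ℝ) R), ← abs_mul,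
      abs_of_nonneg (Nat.cast_nonneg (α := ℝ) R)] at h1
    have e : ∑ n ∈ range N, g n - N * L
        = R * (∑ n ∈ range (N / R), blockAvg R g n - (N / R : ℕ) * L)
          + (∑ n ∈ range (N % R), g (R * (N / R) + n) - (N % R : ℕ) * L) := by
      conv_lhs => rw [← hN]
      rw [sum_range_add, sum_range_mul_blockAvg hR]
      push_cast
      ring
    have hle : (R : ℝ) * (N / R : ℕ) ≤ N := by exact_mod_cast Nat.mul_div_le N R
    rw [e]
    refine (abs_add_le _ _).trans ?_
    nlinarith [mul_le_mul_of_nonneg_left hle hε]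

theorem tendsto_average_of_abs_iterate_blockAvg_sub_le {R : ℕ} (hR : 0 < R) {g : ℕ → ℝ} {L : ℝ}
    (hg : ∀ u, 0 ≤ g u ∧ g u ≤ 1)
    (h : ∀ i u, |(blockAvg R)^[i] g u - L| ≤ (1 - 1 / (R : ℝ)) ^ i) :
    Tendsto (fun N : ℕ => (∑ n ∈ range N, g n) / N) atTop (nhds L) := by
  have hR' : (1 : ℝ) ≤ R := by exact_mod_cast hR
  have hinv : 0 < 1 / (R : ℝ) ∧ 1 / (R : ℝ) ≤ 1 := ⟨by positivity, by
    rw [div_le_one (by positivity)]; exact hR'⟩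
  have hlim : Tendsto (fun i : ℕ => (1 - 1 / (R : ℝ)) ^ i) atTop (nhds 0) :=
    tendsto_pow_atTop_nhds_zero_of_lt_one (by linarith) (by linarith)
  have hconv : Tendsto (fun i => (blockAvg R)^[i] g 0) atTop (nhds L) := by
    rw [tendsto_iff_dist_tendsto_zero]
    exact squeeze_zero (fun _ => dist_nonneg) (fun i => by rw [Real.dist_eq]; exact h i 0) hlim
  have hL : |L| ≤ 1 := by
    rw [abs_le]
    constructor
    · linarith [ge_of_tendsto' hconv fun i => le_iterate_blockAvg hR (fun u => (hg u).1) i 0]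
    · exact le_of_tendsto' hconv fun i => iterate_blockAvg_le hR (fun u => (hg u).2) i 0
  rw [Metric.tendsto_atTop]
  intro ε hε
  obtain ⟨i, hi⟩ := (hlim.eventually (gt_mem_nhds (half_pos hε))).exists
  obtain ⟨K, hK⟩ := abs_sum_range_sub_le hR i hg hL (h i)
  obtain ⟨N₀, hN₀⟩ := exists_nat_gt (2 * K / ε)
  refine ⟨N₀ + 1, fun N hN => ?_⟩
  have hNpos : (0 : ℝ) < N := by exact_mod_cast (by omega : 0 < N)
  have hlt : 2 * K / ε < N := hN₀.trans_le (by exact_mod_cast (by omega : N₀ ≤ N))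
  rw [div_lt_iff₀ hε] at hlt
  have e : (∑ n ∈ range N, g n) / N - L = (∑ n ∈ range N, g n - N * L) / N := by
    field_simp
  rw [Real.dist_eq, e, abs_div, abs_of_pos hNpos, div_lt_iff₀ hNpos]
  refine (hK N).trans_lt ?_
  nlinarith [mul_lt_mul_of_pos_right hi hNpos]

theorem mem_intCantorSet_iff {b : ℕ} (hb : 1 < b) {D : Finset ℕ} (h0 : 0 ∈ D) (m : ℕ) :
    m ∈ intCantorSet b D ↔ m % b ∈ D ∧ m / b ∈ intCantorSet b D := by
  rcases Nat.eq_zero_or_pos m with rfl | hm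
  · simp [intCantorSet, h0]
  · simp [intCantorSet, Nat.digits_def' hb hm]

/-- The increasing enumeration of an integer Cantor set replaces base `#D` digits by the
corresponding elements of `D`. -/
theorem enum_intCantorSet_rec {b : ℕ} {D : Finset ℕ} (hDb : ∀ d ∈ D, d < b)
    (hc2 : 2 ≤ D.card) (h0 : 0 ∈ D) {k : ℕ → ℕ} (hmono : StrictMono k)
    (hrange : Set.range k = intCantorSet b D) :
    k 0 = 0 ∧ ∃ σ : ℕ → ℕ, ∀ n, k n = b * k (n / D.card) + σ (n % D.card) := by
  classical
  have hb : 1 < b := by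
    have : D.card ≤ (range b).card := card_le_card fun d hd => mem_range.2 (hDb d hd)
    rw [card_range] at this
    omega
  set r := D.card with hr
  have hfin : {d | d ∈ D}.Finite := D.finite_toSet
  have hcard : hfin.toFinset.card = r := by
    rw [hr]; congr 1; ext x; simp
  set σ := Nat.nth (· ∈ D) with hσ
  have hσmem : ∀ j < r, σ j ∈ D := fun j hj => Nat.nth_mem_of_lt_card hfin (by rwa [hcard])
  have hσlt : ∀ i j, i < j → j < r → σ i < σ j := fun i j hij hj =>
    Nat.nth_lt_nth_of_lt_card hfin hij (by rwa [hcard])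
  have hσsurj : ∀ d ∈ D, ∃ j < r, σ j = d := fun d hd => by
    obtain ⟨j, hj, hjd⟩ := Nat.exists_lt_card_finite_nth_eq hfin hd
    exact ⟨j, by rwa [hcard] at hj, hjd⟩
  have hσ0 : σ 0 = 0 := Nat.nth_zero_of_zero h0
  let f : ℕ → ℕ := fun n => Nat.ofDigits b ((Nat.digits r n).map σ)
  have hf0 : f 0 = 0 := by simp [f]
  have hf : ∀ n, f n = b * f (n / r) + σ (n % r) := by
    intro n
    rcases Nat.eq_zero_or_pos n with rfl | hn
    · simp [hf0, hσ0]
    · simp only [f]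
      rw [Nat.digits_def' (by omega) hn, List.map_cons, Nat.ofDigits_cons]
      ring
  have hrpos : 0 < r := by omega
  have hfmono : StrictMono f := by
    intro m n hmn
    induction n using Nat.strong_induction_on generalizing m with
    | _ n ih =>
      have hm' := hDb _ (hσmem _ (Nat.mod_lt m hrpos))
      rw [hf m, hf n]
      rcases (Nat.div_le_div_right hmn.le : m / r ≤ n / r).lt_or_eq with hlt | heq
      · have := ih (n / r) (Nat.div_lt_self (by omega) (by omega)) hlt
        nlinarith
      · have h1 := Nat.div_add_mod m r
        have h2 := Nat.div_add_mod n r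
        rw [heq] at h1 ⊢
        have := hσlt (m % r) (n % r) (by omega) (Nat.mod_lt n hrpos)
        omega
  have hfrange : Set.range f = intCantorSet b D := by
    ext m
    constructor
    · rintro ⟨n, rfl⟩
      induction n using Nat.strong_induction_on with
      | _ n ih =>
        rcases Nat.eq_zero_or_pos n with rfl | hn
        · simp [hf0, intCantorSet]
        · have hd := hσmem _ (Nat.mod_lt n hrpos)
          rw [mem_intCantorSet_iff hb h0, hf n, Nat.mul_add_mod, Nat.mod_eq_of_lt (hDb _ hd),
            Nat.mul_add_div (by omega), Nat.div_eq_of_lt (hDb _ hd), add_zero]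
          exact ⟨hd, ih _ (Nat.div_lt_self hn (by omega))⟩
    · intro hm
      induction m using Nat.strong_induction_on with
      | _ m ih =>
        rcases Nat.eq_zero_or_pos m with rfl | hpos
        · exact ⟨0, hf0⟩
        · rw [mem_intCantorSet_iff hb h0] at hm
          obtain ⟨n, hn⟩ := ih _ (Nat.div_lt_self hpos hb) hm.2
          obtain ⟨j, hj, hjd⟩ := hσsurj _ hm.1
          refine ⟨r * n + j, ?_⟩
          rw [hf, Nat.mul_add_mod, Nat.mod_eq_of_lt hj, Nat.mul_add_div hrpos,
            Nat.div_eq_of_lt hj, add_zero, hn, hjd, Nat.div_add_mod]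
  have hkf : k = f := (hmono.range_inj hfmono).1 (hrange.trans hfrange.symm)
  rw [hkf]
  exact ⟨hf0, σ, hf⟩

section DigitRecursion

variable {b r : ℕ} {k σ : ℕ → ℕ}

theorem apply_pow_mul_add (hr : 2 ≤ r) (hk0 : k 0 = 0)
    (hk : ∀ n, k n = b * k (n / r) + σ (n % r)) (M u v : ℕ) (hv : v < r ^ M) :
    k (r ^ M * u + v) = b ^ M * k u + k v := by
  induction M generalizing v with
  | zero =>
    obtain rfl : v = 0 := by simpa using hv
    simp [hk0]
  | succ M ih =>
    have e : r ^ (M + 1) * u + v = r * (r ^ M * u) + v := by ring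
    rw [hk, hk v, e, Nat.mul_add_div (by omega), Nat.mul_add_mod, ih]
    · ring
    · rw [Nat.div_lt_iff_lt_mul (by omega), ← pow_succ]
      exact hv

/-- Every digit string can be extended to one whose value is divisible by `q`. -/
theorem exists_extension_dvd (hr : 2 ≤ r) (hk0 : k 0 = 0)
    (hk : ∀ n, k n = b * k (n / r) + σ (n % r)) {q : ℕ} (hq : 0 < q) (u : ℕ) :
    ∃ t, ∃ v < r ^ t, q ∣ k (r ^ t * u + v) := by
  obtain ⟨s, hs⟩ : ∃ s, u < r ^ s := ⟨u, Nat.lt_pow_self (by omega)⟩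
  have key := apply_pow_mul_add hr hk0 hk
  let y : ℕ → ℕ := fun n => Nat.rec 0 (fun n z => r ^ (s * n) * u + z) n
  have y0 : y 0 = 0 := rfl
  have ysucc : ∀ n, y (n + 1) = r ^ (s * n) * u + y n := fun n => rfl
  have ylt : ∀ n, y n < r ^ (s * n) := by
    intro n
    induction n with
    | zero => simp [y0]
    | succ n ih =>
      rw [ysucc, Nat.mul_succ, pow_add]
      nlinarith
  have yadd : ∀ m n, y (m + n) = r ^ (s * n) * y m + y n := by
    intro m n
    induction m with
    | zero => simp [y0]
    | succ m ih =>
      rw [Nat.succ_add, Nat.succ_eq_add_one, ysucc, ih, ysucc]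
      ring
  have main : ∀ m n, m < n → k (y m) % q = k (y n) % q →
      ∃ t, ∃ v < r ^ t, q ∣ k (r ^ t * u + v) := by
    intro m n hmn hmod
    obtain ⟨d, rfl⟩ := Nat.exists_eq_add_of_lt hmn
    have hpos : 0 < r ^ (s * m) := by positivity
    refine ⟨s * m + s * d, r ^ (s * m) * y d, ?_, ?_⟩
    · rw [pow_add]
      exact Nat.mul_lt_mul_of_pos_left (ylt d) hpos
    · have e : r ^ (s * m + s * d) * u + r ^ (s * m) * y d = r ^ (s * m) * y (d + 1) + 0 := by
        rw [ysucc]; ring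
      have e' : y (m + d + 1) = r ^ (s * m) * y (d + 1) + y m := by
        rw [← yadd (d + 1) m, add_assoc, add_comm]
      rw [e, key _ _ _ hpos, hk0, add_zero]
      rw [e', key _ _ _ (ylt m)] at hmod
      have := (Nat.modEq_iff_dvd' (Nat.le_add_left _ _)).1 hmod
      rwa [Nat.add_sub_cancel] at this
  obtain ⟨m, n, hne, heq⟩ := Finite.exists_ne_map_eq_of_infinite
    fun n => (⟨k (y n) % q, Nat.mod_lt _ hq⟩ : Fin q)
  have heq' : k (y m) % q = k (y n) % q := congrArg Fin.val heq
  rcases hne.lt_or_gt with h | h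
  · exact main m n h heq'
  · exact main n m h heq'.symm

/-- The extension in `exists_extension_dvd` can be chosen of a length not depending on `u`. -/
theorem exists_uniform_extension_dvd (hr : 2 ≤ r) (hk0 : k 0 = 0)
    (hk : ∀ n, k n = b * k (n / r) + σ (n % r)) {q : ℕ} (hq : 0 < q) :
    ∃ M, ∀ u, ∃ v < r ^ M, q ∣ k (r ^ M * u + v) := by
  have key := apply_pow_mul_add hr hk0 hk
  have step : ∀ t s u, (∃ v < r ^ t, q ∣ k (r ^ t * u + v)) →
      ∃ v < r ^ (s + t), q ∣ k (r ^ (s + t) * u + v) := by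
    rintro t s u ⟨v, hv, hdvd⟩
    have hpos : 0 < r ^ s := by positivity
    refine ⟨r ^ s * v, by rw [pow_add]; exact Nat.mul_lt_mul_of_pos_left hv hpos, ?_⟩
    have e : r ^ (s + t) * u + r ^ s * v = r ^ s * (r ^ t * u + v) + 0 := by ring
    rw [e, key _ _ _ hpos, hk0, add_zero]
    exact hdvd.mul_left _
  have hclass : ∀ c, ∃ t, ∀ u, k u % q = c → ∃ v < r ^ t, q ∣ k (r ^ t * u + v) := by
    intro c
    by_cases hc : ∃ u, k u % q = c
    · obtain ⟨u, hu⟩ := hc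
      obtain ⟨t, v, hv, hdvd⟩ := exists_extension_dvd hr hk0 hk hq u
      refine ⟨t, fun w hw => ⟨v, hv, ?_⟩⟩
      rw [key _ _ _ hv] at hdvd ⊢
      have hmod : k w ≡ k u [MOD q] := hw.trans hu.symm
      exact (((hmod.mul_left _).add_right _).dvd_iff dvd_rfl).2 hdvd
    · exact ⟨0, fun u hu => (hc ⟨u, hu⟩).elim⟩
  choose t ht using hclass
  refine ⟨(range q).sup t, fun u => ?_⟩
  have hle : t (k u % q) ≤ (range q).sup t := le_sup (mem_range.2 (Nat.mod_lt _ hq))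
  obtain ⟨s, hs⟩ := Nat.exists_eq_add_of_le' hle
  rw [hs]
  exact step _ s u (ht _ u rfl)

/-- The values at `u` of iterated block averages of a function of `k n % q` depend only on
`k u % q`. -/
theorem iterate_blockAvg_congr {R B q : ℕ} (hk : ∀ u, ∀ v < R, k (R * u + v) = B * k u + k v)
    {g : ℕ → ℝ} (hg : ∀ u w, k u % q = k w % q → g u = g w) (i : ℕ) {u w : ℕ}
    (h : k u % q = k w % q) : (blockAvg R)^[i] g u = (blockAvg R)^[i] g w := by
  induction i generalizing g u w with
  | zero => exact hg u w h
  | succ i ih =>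
    refine ih (fun u w h => ?_) h
    unfold blockAvg
    congr 1
    refine sum_congr rfl fun v hv => hg _ _ ?_
    rw [hk _ _ (mem_range.1 hv), hk _ _ (mem_range.1 hv)]
    exact Nat.ModEq.add_right _ (Nat.ModEq.mul_left _ h)

end DigitRecursion

/-- For every modulus `q ≥ 1` the density `π_q(a)` of `{n : k_n ≡ a mod q}`
exists for every residue `a`, and `π_q(0) > 0`. -/
theorem stmt4 (b : ℕ) (D : Finset ℕ) (hb : 3 ≤ b) (hDb : ∀ d ∈ D, d < b)
    (hc2 : 2 ≤ D.card) (hcb : D.card < b) (h0 : 0 ∈ D)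
    (k : ℕ → ℕ) (hmono : StrictMono k) (hrange : Set.range k = intCantorSet b D)
    (q : ℕ) (hq : 0 < q) :
    (∀ a : ℕ, a < q → ∃ L : ℝ,
      Tendsto (fun N : ℕ =>
          (((Finset.range N).filter fun n => k n % q = a).card : ℝ) / N)
        atTop (nhds L)) ∧
    (∃ L : ℝ, 0 < L ∧
      Tendsto (fun N : ℕ =>
          (((Finset.range N).filter fun n => k n % q = 0).card : ℝ) / N)
        atTop (nhds L)) := by
  obtain ⟨hk0, σ, hk⟩ := enum_intCantorSet_rec hDb hc2 h0 hmono hrange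
  obtain ⟨M, hM⟩ := exists_uniform_extension_dvd hc2 hk0 hk hq
  have hpow : ∀ u, ∀ v < D.card ^ M, k (D.card ^ M * u + v) = b ^ M * k u + k v :=
    apply_pow_mul_add hc2 hk0 hk M
  have hR : 0 < D.card ^ M := Nat.pow_pos (by omega)
  generalize D.card ^ M = R at hM hpow hR
  have main : ∀ a : ℕ, ∃ L : ℝ,
      (∀ i u, |(blockAvg R)^[i] (fun n => if k n % q = a then 1 else 0) u - L|
        ≤ (1 - 1 / (R : ℝ)) ^ i) ∧
      Tendsto (fun N : ℕ => (((range N).filter fun n => k n % q = a).card : ℝ) / N)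
        atTop (nhds L) := by
    intro a
    have hg : ∀ n, (0 : ℝ) ≤ (if k n % q = a then 1 else 0) ∧
        (if k n % q = a then 1 else 0) ≤ (1 : ℝ) := by
      intro n
      split_ifs <;> norm_num
    obtain ⟨L, hL⟩ := exists_abs_iterate_blockAvg_sub_le hR hg fun i u => by
      obtain ⟨v, hv, hdvd⟩ := hM u
      refine ⟨v, hv, iterate_blockAvg_congr (q := q) hpow (fun u w h => by rw [h]) i ?_⟩
      rw [hk0, Nat.zero_mod]
      exact Nat.mod_eq_zero_of_dvd hdvd
    refine ⟨L, hL, ?_⟩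
    simp_rw [natCast_card_filter]
    exact tendsto_average_of_abs_iterate_blockAvg_sub_le hR hg hL
  refine ⟨fun a _ => (main a).imp fun L h => h.2, ?_⟩
  obtain ⟨L, hL, hlim⟩ := main 0
  refine ⟨L, ?_, hlim⟩
  have hR' : (1 : ℝ) ≤ R := by exact_mod_cast hR
  have hinv : 0 < 1 / (R : ℝ) := by positivity
  have hinv' : 1 / (R : ℝ) ≤ 1 := by
    rw [div_le_one (by positivity)]
    exact hR'
  have hlower : ∀ u, 1 / (R : ℝ) ≤ blockAvg R (fun n => if k n % q = 0 then 1 else 0) u := by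
    intro u
    obtain ⟨v, hv, hdvd⟩ := hM u
    unfold blockAvg
    gcongr
    rw [sum_boole, Nat.one_le_cast, Nat.one_le_iff_ne_zero, ← Nat.pos_iff_ne_zero, card_pos]
    exact ⟨v, mem_filter.2 ⟨mem_range.2 hv, Nat.mod_eq_zero_of_dvd hdvd⟩⟩
  obtain ⟨i, hi⟩ := exists_pow_lt_of_lt_one hinv (by linarith : 1 - 1 / (R : ℝ) < 1)
  have h1 := (abs_le.1 (hL (i + 1) 0)).2
  have h2 := le_iterate_blockAvg hR hlower i 0
  rw [← Function.iterate_succ_apply] at h2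
  have h3 : (1 - 1 / (R : ℝ)) ^ (i + 1) ≤ (1 - 1 / (R : ℝ)) ^ i :=
    pow_le_pow_of_le_one (by linarith) (by linarith) (Nat.le_succ i)
  linarith
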